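/- If no solution to Disjoint A,B-paths on G exists, then p(G,s) = 0 in ℤ[s]. -/

import Mathlib

/-- `f` is a family of `(|A|+|B|)/2` pairwise vertex-disjoint simple paths of `G`,
each with both endpoints in `A` or both endpoints in `B`, such that every vertex of
`A ∪ B` is an endpoint of one of the paths, and `E'` is the union of their edge
sets.  This witnesses that `E'` is a solution to Disjoint `A`,`B`-paths. -/
def IsPathFamily {V : Type} [DecidableEq V] (G : SimpleGraph V) (A B : Finset V)
    (E' : Set (Sym2 V)) {k : ℕ} (f : Fin k → (u : V) × (v : V) × G.Walk u v) : Prop :=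
  k = (A.card + B.card) / 2 ∧
  (∀ i, (f i).2.2.IsPath) ∧
  (∀ i, ((f i).1 ∈ A ∧ (f i).2.1 ∈ A) ∨ ((f i).1 ∈ B ∧ (f i).2.1 ∈ B)) ∧
  (∀ i j, i ≠ j → ∀ x, x ∈ (f i).2.2.support → x ∉ (f j).2.2.support) ∧
  (∀ z, z ∈ A ∪ B → ∃ i, z = (f i).1 ∨ z = (f i).2.1) ∧
  E' = ⋃ i, {e | e ∈ (f i).2.2.edges}

/-- `E'` is a solution to Disjoint `A`,`B`-paths on `G`. -/
def IsSolution {V : Type} [DecidableEq V] (G : SimpleGraph V) (A B : Finset V)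
    (E' : Set (Sym2 V)) : Prop :=
  ∃ (k : ℕ) (f : Fin k → (u : V) × (v : V) × G.Walk u v), IsPathFamily G A B E' f

/-- The length of an edge set: the sum of the lengths of its edges. -/
noncomputable def lengthOf {V : Type} (ℓ : Sym2 V → ℕ) (E' : Set (Sym2 V)) : ℕ :=
  ∑ᶠ e ∈ E', ℓ e

/-- `ℓ_{A,B}`: the minimum length of a solution to Disjoint `A`,`B`-paths. -/
noncomputable def lAB {V : Type} [DecidableEq V] (G : SimpleGraph V) (A B : Finset V)
    (ℓ : Sym2 V → ℕ) : ℕ :=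
  sInf {n | ∃ E', IsSolution G A B E' ∧ lengthOf ℓ E' = n}

/-- `S_{A,B}`: the number of minimum-length solutions to Disjoint `A`,`B`-paths. -/
noncomputable def nSol {V : Type} [DecidableEq V] (G : SimpleGraph V) (A B : Finset V)
    (ℓ : Sym2 V → ℕ) : ℕ :=
  Set.ncard {E' | IsSolution G A B E' ∧ lengthOf ℓ E' = lAB G A B ℓ}


/-- The vertex type of the gadget graph `H`: `Sum.inl (v, i)` is the gadget vertex
`hᵢ(v)` and `Sum.inr z` is the terminal center `h(z)` (used only for `z ∈ Z`). -/
abbrev HVert (V : Type) : Type := (V × Fin 3) ⊕ V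

/-- Base relation for the gadget graph `H`: triangle edges inside nonterminal
gadgets, star edges inside terminal gadgets, and external edges between gadgets
(one external edge `h_{idx u (uv)}(u) h_{idx v (uv)}(v)` for every edge `uv` of `G`). -/
def hRel {V : Type} (G : SimpleGraph V) (idx : V → Sym2 V → Fin 3) (Z : Finset V) :
    HVert V → HVert V → Prop
  | .inl (u, i), .inl (w, j) =>
      (u = w ∧ u ∉ Z ∧ i ≠ j) ∨
      (G.Adj u w ∧ idx u s(u, w) = i ∧ idx w s(u, w) = j)
  | .inr z, .inl (w, _) => z ∈ Z ∧ z = w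
  | _, _ => False

/-- The gadget graph `H` (with terminal set `Z`). -/
def gadgetGraph {V : Type} (G : SimpleGraph V) (idx : V → Sym2 V → Fin 3)
    (Z : Finset V) : SimpleGraph (HVert V) :=
  SimpleGraph.fromRel (hRel G idx Z)

/-- The vertex set of `H(X)`: all gadget vertices, and the centers `h(z)` for `z ∈ X`. -/
def gadgetVerts {V : Type} (X : Finset V) : Set (HVert V) :=
  fun x => match x with
  | .inl _ => True
  | .inr z => z ∈ X

/-- `M` is (the edge set of) a perfect matching of `H(X)`. -/
def IsPMgadget {V : Type} (G : SimpleGraph V) (idx : V → Sym2 V → Fin 3)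
    (Z X : Finset V) (M : Finset (Sym2 (HVert V))) : Prop :=
  (∀ e ∈ M, e ∈ (gadgetGraph G idx Z).edgeSet ∧ ∀ x ∈ e, x ∈ gadgetVerts X) ∧
  (∀ x ∈ gadgetVerts X, ∃! e, e ∈ M ∧ x ∈ e)

/-- The endpoint, in the gadget of `u`, of the external edge of `H` representing the
edge `uv'` of `G`; this is `f(uv') = h_{idx u (uv')}(u)`. -/
def fEnd {V : Type} (idx : V → Sym2 V → Fin 3) (u v' : V) : HVert V :=
  Sum.inl (u, idx u s(u, v'))

/-- The external edge of `H` representing an edge of `G`. -/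
def extEdge {V : Type} (idx : V → Sym2 V → Fin 3) : Sym2 V → Sym2 (HVert V) :=
  Sym2.lift ⟨fun u v => s(fEnd idx u v, fEnd idx v u), by
    intro u v
    exact Sym2.eq_swap⟩

open Classical in
/-- The weight of an edge of `H`: `s ^ ℓ(e)` for the external edge representing the
edge `e` of `G`, and `1` for internal edges (as a polynomial in `ℤ[s]`). -/
noncomputable def wt {V : Type} (G : SimpleGraph V) (ℓ : Sym2 V → ℕ)
    (idx : V → Sym2 V → Fin 3) (ε : Sym2 (HVert V)) : Polynomial ℤ :=
  if h : ∃ e, e ∈ G.edgeSet ∧ ε = extEdge idx e then Polynomial.X ^ ℓ h.choose else 1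

open Classical in
/-- `pm(H(X))`: the sum of the weights of all perfect matchings of `H(X)`. -/
noncomputable def pmPoly {V : Type} [Fintype V] [DecidableEq V] (G : SimpleGraph V)
    (ℓ : Sym2 V → ℕ) (idx : V → Sym2 V → Fin 3) (Z X : Finset V) : Polynomial ℤ :=
  ∑ M ∈ Finset.univ.filter (fun M : Finset (Sym2 (HVert V)) => IsPMgadget G idx Z X M),
    ∏ e ∈ M, wt G ℓ idx e

open Classical in
/-- The polynomial `p(G,s) = Σ_{X ⊆ Z} (−1)^{|X∩A|} pm(H(X)) pm(H(Z∖X))`. -/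
noncomputable def pPoly {V : Type} [Fintype V] [DecidableEq V] (G : SimpleGraph V)
    (A B : Finset V) (ℓ : Sym2 V → ℕ) (idx : V → Sym2 V → Fin 3) : Polynomial ℤ :=
  ∑ X ∈ (A ∪ B).powerset,
    (-1 : Polynomial ℤ) ^ (X ∩ A).card *
      (pmPoly G ℓ idx (A ∪ B) X * pmPoly G ℓ idx (A ∪ B) ((A ∪ B) \ X))

/-- `Λ`: the total length of all edges of `G`. -/
noncomputable def totalLen {V : Type} (G : SimpleGraph V) (ℓ : Sym2 V → ℕ) : ℕ :=
  ∑ᶠ e ∈ G.edgeSet, ℓ e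

open Classical in
/-- In a graph whose vertices have degree `1` on `Z` and degree `0` or `2` elsewhere, every
connected component contains an even number of vertices of `Z`, and at most two. -/
lemma card_filter_component_of_degree {V : Type} [Fintype V] (D : SimpleGraph V) (Z : Finset V)
    (h1 : ∀ v ∈ Z, D.degree v = 1) (h2 : ∀ v ∉ Z, D.degree v = 0 ∨ D.degree v = 2)
    (c : D.ConnectedComponent) :
    Even (Z.filter (· ∈ c.supp)).card ∧ (Z.filter (· ∈ c.supp)).card ≤ 2 := by
  have hdeg : ∀ v : c.supp, (D.induce c.supp).degree v = D.degree (v : V) := by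
    intro v
    apply SimpleGraph.degree_induce_of_neighborSet_subset
    intro w hw
    exact c.mem_supp_of_adj_mem_supp v.2 hw
  have hcard : (Z.filter (· ∈ c.supp)).card =
      (Finset.univ.filter (fun v : c.supp => (v : V) ∈ Z)).card := by
    symm
    refine Finset.card_bij (fun v _ => (v : V)) ?_ ?_ ?_
    · intro v hv
      simp only [Finset.mem_filter, Finset.mem_univ, true_and] at hv ⊢
      exact ⟨hv, v.2⟩
    · intro v _ w _ h
      exact Subtype.ext h
    · intro v hv
      simp only [Finset.mem_filter] at hv
      exact ⟨⟨v, hv.2⟩, by simpa using hv.1, rfl⟩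
  have hconn : (D.induce c.supp).Connected := c.connected_toSimpleGraph
  rw [hcard]
  constructor
  · have := (D.induce c.supp).even_card_odd_degree_vertices
    convert this using 3
    rename_i v _
    rw [hdeg]
    constructor
    · intro h
      simp [h1 _ h]
    · intro h
      by_contra hz
      rcases h2 _ hz with h' | h' <;> rw [h'] at h <;> revert h <;> decide
  · have hE := hconn.card_vert_le_card_edgeSet_add_one
    have hS := (D.induce c.supp).sum_degrees_eq_twice_card_edges
    have hle : ∑ v : c.supp, ((D.induce c.supp).degree v + if (v : V) ∈ Z then 1 else 0) ≤
        ∑ _v : c.supp, 2 := by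
      apply Finset.sum_le_sum
      intro v _
      rw [hdeg]
      by_cases hv : (v : V) ∈ Z
      · simp [hv, h1 _ hv]
      · rcases h2 _ hv with h' | h' <;> simp [hv, h']
    rw [Finset.sum_add_distrib, hS, ← Finset.card_filter, Finset.sum_const, smul_eq_mul,
      Finset.card_univ] at hle
    rw [Nat.card_eq_fintype_card, Nat.card_eq_fintype_card,
      ← SimpleGraph.edgeFinset_card] at hE
    omega

open Classical in
/-- A subgraph of `G` with degree `1` on `A ∪ B` and degree `0` or `2` elsewhere, all of whose
components contain an even number of vertices of `A`, contains a solution. -/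
lemma exists_isSolution_of_degree {V : Type} [Fintype V] [DecidableEq V]
    (G D : SimpleGraph V) (A B : Finset V) (hDG : D ≤ G) (hdisj : Disjoint A B)
    (h1 : ∀ v ∈ A ∪ B, D.degree v = 1) (h2 : ∀ v ∉ A ∪ B, D.degree v = 0 ∨ D.degree v = 2)
    (hA : ∀ c : D.ConnectedComponent, Even (A.filter (· ∈ c.supp)).card) :
    ∃ E', IsSolution G A B E' := by
  set Z := A ∪ B with hZ
  set K := Z.image D.connectedComponentMk
  have hmemK : ∀ c ∈ K, ∃ z ∈ Z, z ∈ c.supp := by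
    intro c hc
    obtain ⟨z, hz, rfl⟩ := Finset.mem_image.1 hc
    exact ⟨z, hz, rfl⟩
  have hfib : ∀ c ∈ K, (Z.filter (· ∈ c.supp)).card = 2 := by
    intro c hc
    obtain ⟨z, hz, hzc⟩ := hmemK c hc
    have hc2 : Even (Z.filter (· ∈ c.supp)).card ∧ (Z.filter (· ∈ c.supp)).card ≤ 2 := by
      convert card_filter_component_of_degree D Z h1 h2 c
    obtain ⟨he, hle⟩ := hc2
    have : 0 < (Z.filter (· ∈ c.supp)).card :=
      Finset.card_pos.2 ⟨z, Finset.mem_filter.2 ⟨hz, hzc⟩⟩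
    obtain ⟨m, hm⟩ := he
    omega
  have hcardK : K.card = (A.card + B.card) / 2 := by
    have h := Finset.card_eq_sum_card_fiberwise (f := D.connectedComponentMk) (s := Z) (t := K)
      (fun z hz => Finset.mem_coe.2 (Finset.mem_image_of_mem _ hz))
    have h' : ∀ c ∈ K, (Z.filter (fun z => D.connectedComponentMk z = c)).card = 2 := by
      intro c hc
      convert hfib c hc using 2
      ext z
      simp
    rw [Finset.sum_congr rfl h', Finset.sum_const, smul_eq_mul, hZ,
      Finset.card_union_of_disjoint hdisj] at h
    omega
  have hpath : ∀ c : K, ∃ f : (u : V) × (v : V) × G.Walk u v,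
      Z.filter (· ∈ c.1.supp) = {f.1, f.2.1} ∧ f.2.2.IsPath ∧
      ∀ x ∈ f.2.2.support, x ∈ c.1.supp := by
    rintro ⟨c, hc⟩
    obtain ⟨u, v, huv, hset⟩ := Finset.card_eq_two.1 (hfib c hc)
    have hu : u ∈ Z.filter (· ∈ c.supp) := by rw [hset]; simp
    have hv : v ∈ Z.filter (· ∈ c.supp) := by rw [hset]; simp
    have hu' := (Finset.mem_filter.1 hu).2
    have hv' := (Finset.mem_filter.1 hv).2
    obtain ⟨p, hp⟩ := (c.reachable_of_mem_supp hu' hv').exists_isPath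
    refine ⟨⟨u, v, p.mapLe hDG⟩, hset, hp.mapLe hDG, ?_⟩
    intro x hx
    simp only [SimpleGraph.Walk.support_mapLe_eq_support] at hx
    have : D.Reachable x u := (p.takeUntil x hx).reachable.symm
    rw [SimpleGraph.ConnectedComponent.mem_supp_iff] at hu' ⊢
    exact (SimpleGraph.ConnectedComponent.sound this).trans hu'
  choose f hf1 hf2 hf3 using hpath
  let e : Fin K.card ≃ K := K.equivFin.symm
  refine ⟨_, K.card, fun i => f (e i), hcardK, fun i => hf2 _, ?_, ?_, ?_, rfl⟩
  · intro i
    set c := e i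
    have hset := hf1 c
    have hu : (f c).1 ∈ Z.filter (· ∈ c.1.supp) := by rw [hset]; simp
    have hv : (f c).2.1 ∈ Z.filter (· ∈ c.1.supp) := by rw [hset]; simp
    have hne : (f c).1 ≠ (f c).2.1 := by
      intro h
      have := hfib c.1 c.2
      rw [hset, Finset.card_eq_two] at this
      obtain ⟨x, y, hxy, hs⟩ := this
      have hx : x ∈ ({(f c).1, (f c).2.1} : Finset V) := by rw [hs]; simp
      have hy : y ∈ ({(f c).1, (f c).2.1} : Finset V) := by rw [hs]; simp
      simp only [Finset.mem_insert, Finset.mem_singleton, ← h, or_self] at hx hy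
      exact hxy (hx.trans hy.symm)
    have hsub : A.filter (· ∈ c.1.supp) ⊆ {(f c).1, (f c).2.1} := by
      rw [← hset]
      exact Finset.filter_subset_filter _ Finset.subset_union_left
    have heven := hA c.1
    rw [Finset.mem_filter, hZ, Finset.mem_union] at hu hv
    have key : (f c).1 ∈ A ↔ (f c).2.1 ∈ A := by
      constructor
      · intro h
        by_contra h'
        have : A.filter (· ∈ c.1.supp) = {(f c).1} := by
          ext x
          constructor
          · intro hx
            have := hsub hx
            simp only [Finset.mem_insert, Finset.mem_singleton] at this ⊢
            rcases this with rfl | rfl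
            · rfl
            · exact absurd (Finset.mem_filter.1 hx).1 h'
          · intro hx
            rw [Finset.mem_singleton.1 hx]
            exact Finset.mem_filter.2 ⟨h, hu.2⟩
        rw [this] at heven
        simp at heven
      · intro h
        by_contra h'
        have : A.filter (· ∈ c.1.supp) = {(f c).2.1} := by
          ext x
          constructor
          · intro hx
            have := hsub hx
            simp only [Finset.mem_insert, Finset.mem_singleton] at this ⊢
            rcases this with rfl | rfl
            · exact absurd (Finset.mem_filter.1 hx).1 h'
            · rfl
          · intro hx
            rw [Finset.mem_singleton.1 hx]
            exact Finset.mem_filter.2 ⟨h, hv.2⟩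
        rw [this] at heven
        simp at heven
    tauto
  · intro i j hij x hx hx'
    have h := hf3 _ x hx
    have h' := hf3 _ x hx'
    rw [SimpleGraph.ConnectedComponent.mem_supp_iff] at h h'
    exact hij (e.injective (Subtype.ext (h.symm.trans h')))
  · intro z hz
    let c : K := ⟨D.connectedComponentMk z, Finset.mem_image_of_mem _ hz⟩
    refine ⟨e.symm c, ?_⟩
    show z = (f (e (e.symm c))).1 ∨ z = (f (e (e.symm c))).2.1
    rw [e.apply_symm_apply]
    have : z ∈ Z.filter (· ∈ c.1.supp) := Finset.mem_filter.2 ⟨hz, rfl⟩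
    rw [hf1 c] at this
    simpa using this

open Classical in
/-- The sets of edges of `G` having odd degree at nonterminals, degree `2` at the terminals
in `X`, and degree `3` at the other terminals. -/
def IsExtSet {V : Type} (G : SimpleGraph V) (Z X : Finset V) (F : Finset (Sym2 V)) : Prop :=
  (∀ e ∈ F, e ∈ G.edgeSet) ∧
  ∀ v, (v ∉ Z → Odd (F.filter (v ∈ ·)).card) ∧
    (v ∈ Z → v ∈ X → (F.filter (v ∈ ·)).card = 2) ∧
    (v ∈ Z → v ∉ X → (F.filter (v ∈ ·)).card = 3)

/-- `C` is a union of components of the edge set `D`, with an odd number of vertices in `A`. -/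
def IsOddClosed {V : Type} [DecidableEq V] (A : Finset V) (D : Finset (Sym2 V))
    (C : Finset V) : Prop :=
  (∀ e ∈ D, ∀ u ∈ e, ∀ v ∈ e, u ∈ C → v ∈ C) ∧ Odd (A ∩ C).card

open Classical in
/-- The edge set agreeing with `F'` on edges touching `C` and with `F` on the others. -/
noncomputable def swapOn {V : Type} (C : Finset V) (F F' : Finset (Sym2 V)) :
    Finset (Sym2 V) :=
  F'.filter (fun e => ∃ v ∈ e, v ∈ C) ∪ F.filter (fun e => ¬ ∃ v ∈ e, v ∈ C)

lemma mem_swapOn {V : Type} {C : Finset V} {F F' : Finset (Sym2 V)} {e : Sym2 V} :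
    e ∈ swapOn C F F' ↔ (e ∈ F' ∧ ∃ v ∈ e, v ∈ C) ∨ (e ∈ F ∧ ¬ ∃ v ∈ e, v ∈ C) := by
  classical
  simp only [swapOn, Finset.mem_union, Finset.mem_filter]

lemma swapOn_swapOn {V : Type} (C : Finset V) (F F' : Finset (Sym2 V)) :
    swapOn C (swapOn C F F') (swapOn C F' F) = F := by
  ext e
  simp only [mem_swapOn]
  generalize (∃ v ∈ e, v ∈ C) = P
  tauto

lemma symmDiff_swapOn {V : Type} [DecidableEq V] (C : Finset V) (F F' : Finset (Sym2 V)) :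
    symmDiff (swapOn C F F') (swapOn C F' F) = symmDiff F F' := by
  ext e
  simp only [Finset.mem_symmDiff, mem_swapOn]
  generalize (∃ v ∈ e, v ∈ C) = P
  tauto

open Classical in
lemma filter_swapOn_of_mem {V : Type} {C : Finset V} {v : V} (hv : v ∈ C)
    (F F' : Finset (Sym2 V)) :
    (swapOn C F F').filter (v ∈ ·) = F'.filter (v ∈ ·) := by
  ext e
  simp only [Finset.mem_filter, mem_swapOn]
  constructor
  · rintro ⟨h | h, hve⟩
    · exact ⟨h.1, hve⟩
    · exact absurd ⟨v, hve, hv⟩ h.2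
  · rintro ⟨h, hve⟩
    exact ⟨Or.inl ⟨h, v, hve, hv⟩, hve⟩

open Classical in
lemma filter_swapOn_of_notMem {V : Type} {C : Finset V} {v : V} (hv : v ∉ C)
    (F F' : Finset (Sym2 V))
    (hC : ∀ e, ¬ (e ∈ F ↔ e ∈ F') → ∀ u ∈ e, ∀ v ∈ e, u ∈ C → v ∈ C) :
    (swapOn C F F').filter (v ∈ ·) = F.filter (v ∈ ·) := by
  ext e
  simp only [Finset.mem_filter, mem_swapOn]
  have key : v ∈ e → (∃ u ∈ e, u ∈ C) → (e ∈ F ↔ e ∈ F') := by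
    rintro hve ⟨u, hue, hu⟩
    by_contra h
    exact hv (hC e h u hue v hve hu)
  revert key
  generalize (∃ v ∈ e, v ∈ C) = P
  tauto

lemma prod_swapOn_mul_prod_swapOn {V : Type} {R : Type*} [CommMonoid R] (w : Sym2 V → R)
    (C : Finset V) (F F' : Finset (Sym2 V)) :
    (∏ e ∈ swapOn C F F', w e) * ∏ e ∈ swapOn C F' F, w e =
      (∏ e ∈ F, w e) * ∏ e ∈ F', w e := by
  classical
  have h : ∀ F F' : Finset (Sym2 V), ∏ e ∈ swapOn C F F', w e =
      (∏ e ∈ F' with ∃ v ∈ e, v ∈ C, w e) * ∏ e ∈ F with ¬ ∃ v ∈ e, v ∈ C, w e := by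
    intro F F'
    rw [swapOn, Finset.prod_union]
    rw [Finset.disjoint_left]
    intro e he he'
    exact (Finset.mem_filter.1 he').2 (Finset.mem_filter.1 he).2
  rw [h, h, ← Finset.prod_filter_mul_prod_filter_not F (fun e => ∃ v ∈ e, v ∈ C),
    ← Finset.prod_filter_mul_prod_filter_not F' (fun e => ∃ v ∈ e, v ∈ C)]
  ac_rfl

lemma IsExtSet.swapOn {V : Type} [DecidableEq V] {G : SimpleGraph V} {Z X : Finset V}
    {F F' : Finset (Sym2 V)} (hX : X ⊆ Z) (hF : IsExtSet G Z X F)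
    (hF' : IsExtSet G Z (Z \ X) F') {C : Finset V}
    (hC : ∀ e ∈ symmDiff F F', ∀ u ∈ e, ∀ v ∈ e, u ∈ C → v ∈ C) :
    IsExtSet G Z (symmDiff X (Z ∩ C)) (swapOn C F F') := by
  refine ⟨?_, fun v => ?_⟩
  · intro e he
    rcases mem_swapOn.1 he with h | h
    · exact hF'.1 e h.1
    · exact hF.1 e h.1
  · have hXv := @hX v
    simp only [Finset.mem_symmDiff, Finset.mem_inter]
    by_cases hv : v ∈ C
    · rw [filter_swapOn_of_mem hv]
      have h := hF'.2 v
      simp only [Finset.mem_sdiff] at h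
      tauto
    · rw [filter_swapOn_of_notMem hv F F' fun e he =>
        hC e (by rw [Finset.mem_symmDiff]; tauto)]
      have h := hF.2 v
      tauto

/-- The signed sum over pairs of edge sets vanishes if the symmetric difference of each pair
admits a closed vertex set with an odd number of vertices in `A`. -/
lemma sum_isExtSet_eq_zero {V : Type} [Fintype V] [DecidableEq V] {R : Type*} [CommRing R]
    (G : SimpleGraph V) (A Z : Finset V) (hAZ : A ⊆ Z) (w : Sym2 V → R)
    (S : Finset V → Finset (Finset (Sym2 V)))
    (hS : ∀ X F, F ∈ S X ↔ IsExtSet G Z X F)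
    (hodd : ∀ X ⊆ Z, ∀ F F', IsExtSet G Z X F → IsExtSet G Z (Z \ X) F' →
      ∃ C, IsOddClosed A (symmDiff F F') C) :
    ∑ X ∈ Z.powerset, (-1 : R) ^ (X ∩ A).card *
      ((∑ F ∈ S X, ∏ e ∈ F, w e) * ∑ F ∈ S (Z \ X), ∏ e ∈ F, w e) = 0 := by
  classical
  choose! c hc using fun (D : Finset (Sym2 V)) (h : ∃ C, IsOddClosed A D C) => h
  have hc' : ∀ X ⊆ Z, ∀ F F', IsExtSet G Z X F → IsExtSet G Z (Z \ X) F' →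
      IsOddClosed A (symmDiff F F') (c (symmDiff F F')) := by
    intro X hX F F' hF hF'
    exact hc _ (hodd X hX F F' hF hF')
  have hsum : ∀ X ∈ Z.powerset, (-1 : R) ^ (X ∩ A).card *
      ((∑ F ∈ S X, ∏ e ∈ F, w e) * ∑ F ∈ S (Z \ X), ∏ e ∈ F, w e) =
      ∑ q ∈ S X ×ˢ S (Z \ X),
        (-1 : R) ^ (X ∩ A).card * ((∏ e ∈ q.1, w e) * ∏ e ∈ q.2, w e) := by
    intro X _
    rw [Finset.sum_mul_sum, ← Finset.sum_product', Finset.mul_sum]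
  rw [Finset.sum_congr rfl hsum, Finset.sum_sigma']
  have hmem : ∀ t : (_ : Finset V) × (Finset (Sym2 V) × Finset (Sym2 V)),
      t ∈ Z.powerset.sigma (fun X => S X ×ˢ S (Z \ X)) ↔
        t.1 ⊆ Z ∧ IsExtSet G Z t.1 t.2.1 ∧ IsExtSet G Z (Z \ t.1) t.2.2 := by
    intro t
    simp [hS]
  have hsign : ∀ X C : Finset V, Odd (A ∩ C).card →
      (-1 : R) ^ (symmDiff X (Z ∩ C) ∩ A).card = - (-1 : R) ^ (X ∩ A).card := by
    intro X C hC
    have hset : symmDiff X (Z ∩ C) ∩ A = symmDiff (X ∩ A) (A ∩ C) := by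
      ext x
      have := @hAZ x
      simp only [Finset.mem_inter, Finset.mem_symmDiff]
      tauto
    have hcard : (symmDiff (X ∩ A) (A ∩ C)).card + 2 * ((X ∩ A) ∩ (A ∩ C)).card =
        (X ∩ A).card + (A ∩ C).card := by
      have h1 := Finset.card_sdiff_add_card_inter (X ∩ A) (A ∩ C)
      have h2 := Finset.card_sdiff_add_card_inter (A ∩ C) (X ∩ A)
      rw [Finset.inter_comm (A ∩ C)] at h2
      have h3 : (symmDiff (X ∩ A) (A ∩ C)).card =
          ((X ∩ A) \ (A ∩ C)).card + ((A ∩ C) \ (X ∩ A)).card := by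
        rw [symmDiff_def, Finset.sup_eq_union, Finset.card_union_of_disjoint]
        exact disjoint_sdiff_sdiff
      omega
    obtain ⟨m, hm⟩ := hC
    rw [hset]
    have h1 : (-1 : R) ^ ((symmDiff (X ∩ A) (A ∩ C)).card + 2 * ((X ∩ A) ∩ (A ∩ C)).card) =
        (-1 : R) ^ ((X ∩ A).card + (A ∩ C).card) := by rw [hcard]
    rw [pow_add, pow_add, hm, pow_succ, pow_mul, pow_mul] at h1
    simpa using h1
  refine Finset.sum_involution
    (fun t _ => ⟨symmDiff t.1 (Z ∩ c (symmDiff t.2.1 t.2.2)),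
      swapOn (c (symmDiff t.2.1 t.2.2)) t.2.1 t.2.2,
      swapOn (c (symmDiff t.2.1 t.2.2)) t.2.2 t.2.1⟩) ?_ ?_ ?_ ?_
  · rintro ⟨X, F, F'⟩ ht
    obtain ⟨hX, hF, hF'⟩ := (hmem _).1 ht
    simp only
    rw [hsign _ _ (hc' X hX F F' hF hF').2, prod_swapOn_mul_prod_swapOn]
    ring
  · rintro ⟨X, F, F'⟩ ht - heq
    obtain ⟨hX, hF, hF'⟩ := (hmem _).1 ht
    have hodd' := (hc' X hX F F' hF hF').2
    have h1 : symmDiff X (Z ∩ c (symmDiff F F')) = X := congrArg Sigma.fst heq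
    rw [symmDiff_eq_left] at h1
    have h2 : A ∩ c (symmDiff F F') ⊆ Z ∩ c (symmDiff F F') :=
      Finset.inter_subset_inter_right hAZ
    rw [h1] at h2
    rw [Finset.subset_empty.1 h2] at hodd'
    simp at hodd'
  · rintro ⟨X, F, F'⟩ ht
    obtain ⟨hX, hF, hF'⟩ := (hmem _).1 ht
    have hC := (hc' X hX F F' hF hF').1
    rw [hmem]
    refine ⟨?_, hF.swapOn hX hF' hC, ?_⟩
    · intro x hx
      have := @hX x
      simp only [Finset.mem_symmDiff, Finset.mem_inter] at hx
      tauto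
    · have h := IsExtSet.swapOn (Finset.sdiff_subset (s := Z) (t := X)) hF'
        (by rwa [Finset.sdiff_sdiff_eq_self hX]) (C := c (symmDiff F F'))
        (by rwa [symmDiff_comm])
      convert h using 1
      ext x
      have := @hX x
      simp only [Finset.mem_symmDiff, Finset.mem_inter, Finset.mem_sdiff]
      tauto
  · rintro ⟨X, F, F'⟩ ht
    simp only
    rw [symmDiff_swapOn, swapOn_swapOn, swapOn_swapOn, symmDiff_symmDiff_cancel_right]

/-- The gadget vertex `hᵢ(v)` is not covered by the external edges representing `F`. -/
def IsFree {V : Type} (idx : V → Sym2 V → Fin 3) (F : Finset (Sym2 V)) (v : V)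
    (i : Fin 3) : Prop :=
  ∀ e ∈ F, v ∈ e → idx v e ≠ i

open Classical in
lemma card_filter_mem_add_card_isFree {V : Type} {G : SimpleGraph V}
    {idx : V → Sym2 V → Fin 3} (hidx : ∀ v : V, Set.InjOn (idx v) (G.incidenceSet v))
    {F : Finset (Sym2 V)} (hF : ∀ e ∈ F, e ∈ G.edgeSet) (v : V) :
    (F.filter (v ∈ ·)).card +
      (Finset.univ.filter (IsFree idx F v)).card = 3 := by
  have himg : (F.filter (v ∈ ·)).card = ((F.filter (v ∈ ·)).image (idx v)).card := by
    rw [Finset.card_image_of_injOn]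
    intro e he e' he' h
    have h1 := Finset.mem_filter.1 (Finset.mem_coe.1 he)
    have h2 := Finset.mem_filter.1 (Finset.mem_coe.1 he')
    exact hidx v ⟨hF e h1.1, h1.2⟩ ⟨hF e' h2.1, h2.2⟩ h
  have hcompl : Finset.univ.filter (IsFree idx F v) =
      ((F.filter (v ∈ ·)).image (idx v))ᶜ := by
    ext i
    simp only [IsFree, Finset.mem_filter, Finset.mem_univ, true_and, Finset.mem_compl,
      Finset.mem_image, not_exists, not_and, and_imp]
  rw [himg, hcompl, Finset.card_add_card_compl, Fintype.card_fin]

/-- Without a solution, the symmetric difference of complementary edge sets has a component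
containing an odd number of vertices in `A`. -/
lemma exists_isOddClosed_symmDiff {V : Type} [Fintype V] [DecidableEq V]
    {G : SimpleGraph V} {A B : Finset V} {idx : V → Sym2 V → Fin 3}
    (hdisj : Disjoint A B) (hidx : ∀ v : V, Set.InjOn (idx v) (G.incidenceSet v))
    (hnosol : ¬ ∃ E', IsSolution G A B E') {X : Finset V} {F F' : Finset (Sym2 V)}
    (hF : IsExtSet G (A ∪ B) X F) (hF' : IsExtSet G (A ∪ B) ((A ∪ B) \ X) F') :
    ∃ C, IsOddClosed A (symmDiff F F') C := by
  classical
  by_contra hno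
  apply hnosol
  set D := SimpleGraph.fromEdgeSet (V := V) (symmDiff F F' : Finset (Sym2 V)) with hD
  have hsub : ∀ e ∈ symmDiff F F', e ∈ G.edgeSet := by
    intro e he
    rcases Finset.mem_symmDiff.1 he with h | h
    · exact hF.1 e h.1
    · exact hF'.1 e h.1
  have hadj : ∀ u v, D.Adj u v ↔ s(u, v) ∈ symmDiff F F' := by
    intro u v
    rw [hD, SimpleGraph.fromEdgeSet_adj, Finset.mem_coe]
    refine ⟨And.left, fun h => ⟨h, ?_⟩⟩
    exact G.ne_of_adj (hsub _ h)
  have hDG : D ≤ G := fun u v h => hsub _ ((hadj u v).1 h)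
  have hdegree : ∀ v, D.degree v = ((symmDiff F F').filter (v ∈ ·)).card := by
    intro v
    rw [← SimpleGraph.card_incidenceFinset_eq_degree]
    congr 1
    ext e
    rw [SimpleGraph.mem_incidenceFinset, Finset.mem_filter]
    refine and_congr_left fun _ => ?_
    induction e with
    | _ x y => exact hadj x y
  have hcard : ∀ v, D.degree v ≤ 3 ∧
      D.degree v + (F.filter (v ∈ ·)).card + (F'.filter (v ∈ ·)).card ≤ 6 ∧
      Even (D.degree v + (F.filter (v ∈ ·)).card + (F'.filter (v ∈ ·)).card) := by
    intro v
    have hU : ∀ e ∈ F ∪ F', e ∈ G.edgeSet := by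
      intro e he
      rcases Finset.mem_union.1 he with h | h
      · exact hF.1 e h
      · exact hF'.1 e h
    have h1 := card_filter_mem_add_card_isFree hidx hU v
    rw [hdegree]
    have hs : (symmDiff F F').filter (v ∈ ·) =
        (F.filter (v ∈ ·) \ F'.filter (v ∈ ·)) ∪ (F'.filter (v ∈ ·) \ F.filter (v ∈ ·)) := by
      ext e
      simp only [Finset.mem_filter, Finset.mem_symmDiff, Finset.mem_union, Finset.mem_sdiff]
      tauto
    have h2 := Finset.card_union_of_disjoint
      (disjoint_sdiff_sdiff (x := F.filter (v ∈ ·)) (y := F'.filter (v ∈ ·)))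
    have h3 := Finset.card_sdiff_add_card (F.filter (v ∈ ·)) (F'.filter (v ∈ ·))
    have h4 := Finset.card_sdiff_add_card (F'.filter (v ∈ ·)) (F.filter (v ∈ ·))
    rw [Finset.union_comm, ← Finset.filter_union] at h4
    rw [← Finset.filter_union] at h3
    have h5 := Finset.card_le_card
      (Finset.sdiff_subset (s := F.filter (v ∈ ·)) (t := F'.filter (v ∈ ·)))
    have h6 : ((symmDiff F F').filter (v ∈ ·)).card ≤ ((F ∪ F').filter (v ∈ ·)).card := by
      apply Finset.card_le_card
      apply Finset.filter_subset_filter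
      intro e he
      rw [Finset.mem_symmDiff] at he
      rw [Finset.mem_union]
      tauto
    have h7 : ((F ∪ F').filter (v ∈ ·)).card ≤ 3 := by
      convert Nat.le.intro h1
    rw [hs] at h6 ⊢
    refine ⟨by omega, by omega, ?_⟩
    rw [Nat.even_iff]
    omega
  refine exists_isSolution_of_degree G D A B hDG hdisj ?_ ?_ ?_
  · intro v hv
    obtain ⟨-, h1, h2⟩ := hcard v
    have h3 := (hF.2 v).2
    have h4 := (hF'.2 v).2
    rw [Nat.even_iff] at h2
    have h5 : (F.filter (v ∈ ·)).card + (F'.filter (v ∈ ·)).card = 5 := by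
      by_cases hX : v ∈ X
      · have ha := h3.1 hv hX
        have hb := h4.2 hv (by simp [hX])
        convert congrArg₂ (· + ·) ha hb
      · have ha := h3.2 hv hX
        have hb := h4.1 hv (Finset.mem_sdiff.2 ⟨hv, hX⟩)
        convert congrArg₂ (· + ·) ha hb
    convert (show D.degree v = 1 by omega)
  · intro v hv
    obtain ⟨h0, h1, h2⟩ := hcard v
    have ha : Odd (F.filter (v ∈ ·)).card := by convert (hF.2 v).1 hv
    have hb : Odd (F'.filter (v ∈ ·)).card := by convert (hF'.2 v).1 hv
    rw [Nat.even_iff] at h2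
    rw [Nat.odd_iff] at ha hb
    convert (show D.degree v = 0 ∨ D.degree v = 2 by omega)
  · intro c
    by_contra hodd
    rw [Nat.not_even_iff_odd] at hodd
    refine hno ⟨Finset.univ.filter (· ∈ c.supp), ?_, ?_⟩
    · intro e he u hu v hv huC
      simp only [Finset.mem_filter, Finset.mem_univ, true_and] at huC ⊢
      by_cases huv : u = v
      · exact huv ▸ huC
      · have hes : e = s(u, v) := (Sym2.mem_and_mem_iff huv).1 ⟨hu, hv⟩
        have : D.Adj u v := (hadj u v).2 (hes ▸ he)
        exact c.mem_supp_of_adj_mem_supp huC this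
    · convert hodd using 2
      ext x
      simp

lemma inl_mem_extEdge {V : Type} {idx : V → Sym2 V → Fin 3} {v : V} {i : Fin 3} {e : Sym2 V} :
    Sum.inl (v, i) ∈ extEdge idx e ↔ v ∈ e ∧ idx v e = i := by
  induction e with
  | _ x y =>
    simp only [extEdge, fEnd, Sym2.lift_mk, Sym2.mem_iff, Sum.inl.injEq, Prod.mk.injEq]
    constructor
    · rintro (⟨rfl, rfl⟩ | ⟨rfl, rfl⟩)
      · exact ⟨Or.inl rfl, rfl⟩
      · exact ⟨Or.inr rfl, by rw [Sym2.eq_swap]⟩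
    · rintro ⟨rfl | rfl, rfl⟩
      · exact Or.inl ⟨rfl, rfl⟩
      · exact Or.inr ⟨rfl, by rw [Sym2.eq_swap]⟩

lemma inr_notMem_extEdge {V : Type} {idx : V → Sym2 V → Fin 3} {z : V} {e : Sym2 V} :
    Sum.inr z ∉ extEdge idx e := by
  induction e with
  | _ x y => simp [extEdge, fEnd]

lemma extEdge_injective {V : Type} (idx : V → Sym2 V → Fin 3) :
    Function.Injective (extEdge idx) := by
  intro e e' h
  have key : ∀ e v, v ∈ e ↔ ∃ i, Sum.inl (v, i) ∈ extEdge idx e := by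
    intro e v
    simp only [inl_mem_extEdge, exists_and_left, exists_eq', and_true]
  ext v
  rw [key e, key e', h]

/-- The edges of the gadget graph are the external edges, the triangle edges and the star
edges. -/
lemma mem_edgeSet_gadgetGraph {V : Type} {G : SimpleGraph V} {idx : V → Sym2 V → Fin 3}
    {Z : Finset V} {ε : Sym2 (HVert V)} :
    ε ∈ (gadgetGraph G idx Z).edgeSet ↔
      (∃ e ∈ G.edgeSet, ε = extEdge idx e) ∨
      (∃ v ∉ Z, ∃ i j, i ≠ j ∧ ε = s(Sum.inl (v, i), Sum.inl (v, j))) ∨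
      (∃ z ∈ Z, ∃ i, ε = s(Sum.inr z, Sum.inl (z, i))) := by
  constructor
  · induction ε with
    | _ x y =>
      rw [SimpleGraph.mem_edgeSet, gadgetGraph, SimpleGraph.fromRel_adj]
      have main : ∀ x y, hRel G idx Z x y →
          (∃ e ∈ G.edgeSet, s(x, y) = extEdge idx e) ∨
          (∃ v ∉ Z, ∃ i j, i ≠ j ∧ s(x, y) = s(Sum.inl (v, i), Sum.inl (v, j))) ∨
          (∃ z ∈ Z, ∃ i, s(x, y) = s(Sum.inr z, Sum.inl (z, i))) := by
        rintro (⟨u, i⟩ | z) (⟨w, j⟩ | z') h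
        · rcases h with ⟨rfl, hu, hij⟩ | ⟨hadj, rfl, rfl⟩
          · exact Or.inr (Or.inl ⟨u, hu, i, j, hij, rfl⟩)
          · refine Or.inl ⟨s(u, w), hadj, ?_⟩
            simp only [extEdge, fEnd, Sym2.lift_mk]
            rw [Sym2.eq_swap (a := w) (b := u)]
        · exact h.elim
        · obtain ⟨hz, rfl⟩ := h
          exact Or.inr (Or.inr ⟨z, hz, j, rfl⟩)
        · exact h.elim
      rintro ⟨-, h | h⟩
      · exact main x y h
      · rw [Sym2.eq_swap]
        exact main y x h
  · rintro (⟨e, he, rfl⟩ | ⟨v, hv, i, j, hij, rfl⟩ | ⟨z, hz, i, rfl⟩)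
    · induction e with
      | _ x y =>
        rw [SimpleGraph.mem_edgeSet] at he
        simp only [extEdge, fEnd, Sym2.lift_mk]
        rw [SimpleGraph.mem_edgeSet, gadgetGraph, SimpleGraph.fromRel_adj]
        refine ⟨?_, Or.inl (Or.inr ⟨he, rfl, ?_⟩)⟩
        · intro h
          simp only [Sum.inl.injEq, Prod.mk.injEq] at h
          exact he.ne h.1
        · rw [Sym2.eq_swap]
    · rw [SimpleGraph.mem_edgeSet, gadgetGraph, SimpleGraph.fromRel_adj]
      refine ⟨by simpa using hij, Or.inl (Or.inl ⟨rfl, hv, hij⟩)⟩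
    · rw [SimpleGraph.mem_edgeSet, gadgetGraph, SimpleGraph.fromRel_adj]
      exact ⟨by simp, Or.inl ⟨hz, rfl⟩⟩

open Classical in
/-- The edges of `G` whose external edge lies in `M`. -/
noncomputable def extPart {V : Type} [Fintype V] (G : SimpleGraph V) (idx : V → Sym2 V → Fin 3)
    (M : Finset (Sym2 (HVert V))) : Finset (Sym2 V) :=
  Finset.univ.filter (fun e => e ∈ G.edgeSet ∧ extEdge idx e ∈ M)

open Classical in
/-- The external edges representing `F`, together with all edges of `H(X)` inside gadgets
between vertices not covered by them. -/
noncomputable def extendExt {V : Type} [Fintype V] (idx : V → Sym2 V → Fin 3)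
    (Z X : Finset V) (F : Finset (Sym2 V)) : Finset (Sym2 (HVert V)) :=
  Finset.univ.filter (fun ε =>
    (∃ e ∈ F, ε = extEdge idx e) ∨
    (∃ v ∉ Z, ∃ i j, i ≠ j ∧ IsFree idx F v i ∧ IsFree idx F v j ∧
      ε = s(Sum.inl (v, i), Sum.inl (v, j))) ∨
    (∃ z ∈ Z, z ∈ X ∧ ∃ i, IsFree idx F z i ∧ ε = s(Sum.inr z, Sum.inl (z, i))))

lemma mem_extPart {V : Type} [Fintype V] {G : SimpleGraph V} {idx : V → Sym2 V → Fin 3}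
    {M : Finset (Sym2 (HVert V))} {e : Sym2 V} :
    e ∈ extPart G idx M ↔ e ∈ G.edgeSet ∧ extEdge idx e ∈ M := by
  simp [extPart]

lemma mem_extendExt {V : Type} [Fintype V] {idx : V → Sym2 V → Fin 3}
    {Z X : Finset V} {F : Finset (Sym2 V)} {ε : Sym2 (HVert V)} :
    ε ∈ extendExt idx Z X F ↔
      (∃ e ∈ F, ε = extEdge idx e) ∨
      (∃ v ∉ Z, ∃ i j, i ≠ j ∧ IsFree idx F v i ∧ IsFree idx F v j ∧
        ε = s(Sum.inl (v, i), Sum.inl (v, j))) ∨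
      (∃ z ∈ Z, z ∈ X ∧ ∃ i, IsFree idx F z i ∧ ε = s(Sum.inr z, Sum.inl (z, i))) := by
  simp [extendExt]

lemma triangle_ne_extEdge {V : Type} {idx : V → Sym2 V → Fin 3} {v : V} {i j : Fin 3}
    (hij : i ≠ j) (e : Sym2 V) :
    (s(Sum.inl (v, i), Sum.inl (v, j)) : Sym2 (HVert V)) ≠ extEdge idx e := by
  intro h
  have h1 : Sum.inl (v, i) ∈ extEdge idx e := by rw [← h]; simp
  have h2 : Sum.inl (v, j) ∈ extEdge idx e := by rw [← h]; simp
  exact hij ((inl_mem_extEdge.1 h1).2.symm.trans (inl_mem_extEdge.1 h2).2)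

lemma star_ne_extEdge {V : Type} {idx : V → Sym2 V → Fin 3} {v : V} {x : HVert V}
    (e : Sym2 V) :
    (s(Sum.inr v, x) : Sym2 (HVert V)) ≠ extEdge idx e := by
  intro h
  have h1 : Sum.inr v ∈ extEdge idx e := by rw [← h]; simp
  exact inr_notMem_extEdge h1

lemma extPart_extendExt {V : Type} [Fintype V] {G : SimpleGraph V}
    {idx : V → Sym2 V → Fin 3} {Z X : Finset V} {F : Finset (Sym2 V)}
    (hF : ∀ e ∈ F, e ∈ G.edgeSet) : extPart G idx (extendExt idx Z X F) = F := by
  ext e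
  rw [mem_extPart, mem_extendExt]
  constructor
  · rintro ⟨-, ⟨e', he', h⟩ | ⟨v, -, i, j, hij, -, -, h⟩ | ⟨z, -, -, i, -, h⟩⟩
    · exact extEdge_injective idx h ▸ he'
    · exact absurd h.symm (triangle_ne_extEdge hij e)
    · exact absurd h.symm (star_ne_extEdge e)
  · exact fun he => ⟨hF e he, Or.inl ⟨e, he, rfl⟩⟩

lemma prod_wt_eq_prod_extPart {V : Type} [Fintype V] (G : SimpleGraph V) (ℓ : Sym2 V → ℕ)
    (idx : V → Sym2 V → Fin 3) (M : Finset (Sym2 (HVert V))) :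
    ∏ ε ∈ M, wt G ℓ idx ε = ∏ e ∈ extPart G idx M, (Polynomial.X : Polynomial ℤ) ^ ℓ e := by
  classical
  have hsub : (extPart G idx M).image (extEdge idx) ⊆ M := by
    intro ε hε
    obtain ⟨e, he, rfl⟩ := Finset.mem_image.1 hε
    exact (mem_extPart.1 he).2
  rw [← Finset.prod_subset hsub, Finset.prod_image]
  · refine Finset.prod_congr rfl fun e he => ?_
    have h : ∃ e', e' ∈ G.edgeSet ∧ extEdge idx e = extEdge idx e' :=
      ⟨e, (mem_extPart.1 he).1, rfl⟩
    rw [wt, dif_pos h, ← extEdge_injective idx h.choose_spec.2]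
  · exact fun e _ e' _ h => extEdge_injective idx h
  · intro ε hε hne
    rw [wt, dif_neg]
    rintro ⟨e, he, rfl⟩
    exact hne (Finset.mem_image_of_mem _ (mem_extPart.2 ⟨he, hε⟩))

lemma IsPMgadget.eq_of_mem {V : Type} {G : SimpleGraph V} {idx : V → Sym2 V → Fin 3}
    {Z X : Finset V} {M : Finset (Sym2 (HVert V))} (hM : IsPMgadget G idx Z X M)
    {ε ε' : Sym2 (HVert V)} (hε : ε ∈ M) (hε' : ε' ∈ M) {x : HVert V} (hx : x ∈ ε)
    (hx' : x ∈ ε') : ε = ε' :=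
  (hM.2 x ((hM.1 ε hε).2 x hx)).unique ⟨hε, hx⟩ ⟨hε', hx'⟩

lemma IsPMgadget.isFree_of_mem {V : Type} [Fintype V] {G : SimpleGraph V}
    {idx : V → Sym2 V → Fin 3} {Z X : Finset V} {M : Finset (Sym2 (HVert V))}
    (hM : IsPMgadget G idx Z X M) {ε : Sym2 (HVert V)} (hε : ε ∈ M)
    (hne : ∀ e, ε ≠ extEdge idx e) {v : V} {i : Fin 3} (hv : Sum.inl (v, i) ∈ ε) :
    IsFree idx (extPart G idx M) v i := by
  intro e he hve hi
  exact hne e (hM.eq_of_mem hε (mem_extPart.1 he).2 hv (inl_mem_extEdge.2 ⟨hve, hi⟩))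

/-- A gadget vertex not covered externally is matched inside its gadget. -/
lemma IsPMgadget.exists_of_isFree {V : Type} [Fintype V] {G : SimpleGraph V}
    {idx : V → Sym2 V → Fin 3} {Z X : Finset V} {M : Finset (Sym2 (HVert V))}
    (hM : IsPMgadget G idx Z X M) {v : V} {i : Fin 3}
    (hi : IsFree idx (extPart G idx M) v i) :
    (v ∉ Z ∧ ∃ j, i ≠ j ∧ s(Sum.inl (v, i), Sum.inl (v, j)) ∈ M) ∨
      (v ∈ Z ∧ v ∈ X ∧ s(Sum.inr v, Sum.inl (v, i)) ∈ M) := by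
  obtain ⟨ε, ⟨hε, hvε⟩, -⟩ := hM.2 (Sum.inl (v, i)) trivial
  have h := hM.1 ε hε
  rcases mem_edgeSet_gadgetGraph.1 h.1 with
    ⟨e, he, rfl⟩ | ⟨u, hu, k, j, hkj, rfl⟩ | ⟨z, hz, k, rfl⟩
  · obtain ⟨hve, hie⟩ := inl_mem_extEdge.1 hvε
    exact absurd hie (hi e (mem_extPart.2 ⟨he, hε⟩) hve)
  · left
    simp only [Sym2.mem_iff, Sum.inl.injEq, Prod.mk.injEq] at hvε
    rcases hvε with ⟨rfl, rfl⟩ | ⟨rfl, rfl⟩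
    · exact ⟨hu, j, hkj, hε⟩
    · exact ⟨hu, k, hkj.symm, by rwa [Sym2.eq_swap]⟩
  · right
    simp only [Sym2.mem_iff, Sum.inl.injEq, Prod.mk.injEq, reduceCtorEq, false_or] at hvε
    obtain ⟨rfl, rfl⟩ := hvε
    exact ⟨hz, h.2 (Sum.inr v) (by simp), hε⟩

lemma even_card_of_involution_fin_three : ∀ (T : Finset (Fin 3)) (g : Fin 3 → Fin 3),
    (∀ i ∈ T, g i ∈ T ∧ i ≠ g i ∧ g (g i) = i) → Even T.card := by
  decide

lemma eq_of_involution_fin_three : ∀ (T : Finset (Fin 3)) (g : Fin 3 → Fin 3),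
    (∀ i ∈ T, g i ∈ T ∧ i ≠ g i ∧ g (g i) = i) →
      ∀ i j : Fin 3, i ∈ T → j ∈ T → i ≠ j → g i = j := by
  decide

lemma exists_unique_ne_of_even_fin_three : ∀ T : Finset (Fin 3), Even T.card →
    ∀ i ∈ T, ∃ j ∈ T, i ≠ j ∧ ∀ k ∈ T, i ≠ k → k = j := by
  decide

open Classical in
lemma IsPMgadget.even_card_isFree {V : Type} [Fintype V] {G : SimpleGraph V}
    {idx : V → Sym2 V → Fin 3} {Z X : Finset V} {M : Finset (Sym2 (HVert V))}
    (hM : IsPMgadget G idx Z X M) {v : V} (hv : v ∉ Z) :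
    Even (Finset.univ.filter (IsFree idx (extPart G idx M) v)).card ∧
      ∀ i j, IsFree idx (extPart G idx M) v i → IsFree idx (extPart G idx M) v j → i ≠ j →
        s(Sum.inl (v, i), Sum.inl (v, j)) ∈ M := by
  have hex : ∀ i, IsFree idx (extPart G idx M) v i →
      ∃ j, i ≠ j ∧ s(Sum.inl (v, i), Sum.inl (v, j)) ∈ M := by
    intro i hi
    rcases hM.exists_of_isFree hi with h | h
    · exact h.2
    · exact absurd h.1 hv
  choose! g hg1 hg2 using hex
  have hfree : ∀ i, IsFree idx (extPart G idx M) v i →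
      IsFree idx (extPart G idx M) v (g i) := by
    intro i hi
    exact hM.isFree_of_mem (hg2 i hi) (triangle_ne_extEdge (hg1 i hi)) (by simp)
  have hinv : ∀ i ∈ Finset.univ.filter (IsFree idx (extPart G idx M) v),
      g i ∈ Finset.univ.filter (IsFree idx (extPart G idx M) v) ∧ i ≠ g i ∧ g (g i) = i := by
    intro i hi
    have hi' := (Finset.mem_filter.1 hi).2
    refine ⟨Finset.mem_filter.2 ⟨Finset.mem_univ _, hfree i hi'⟩, hg1 i hi', ?_⟩
    have heq := hM.eq_of_mem (hg2 i hi') (hg2 _ (hfree i hi')) (x := Sum.inl (v, g i))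
      (by simp) (by simp)
    rw [Sym2.eq_swap, Sym2.congr_right] at heq
    simpa using heq.symm
  refine ⟨even_card_of_involution_fin_three _ g hinv, fun i j hi hj hij => ?_⟩
  rw [← eq_of_involution_fin_three _ g hinv i j (by simpa using hi) (by simpa using hj) hij]
  exact hg2 i hi

open Classical in
lemma IsExtSet.card_isFree {V : Type} {G : SimpleGraph V} {idx : V → Sym2 V → Fin 3}
    (hidx : ∀ v : V, Set.InjOn (idx v) (G.incidenceSet v)) {Z X : Finset V}
    {F : Finset (Sym2 V)} (hF : IsExtSet G Z X F) (v : V) :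
    (v ∉ Z → Even (Finset.univ.filter (IsFree idx F v)).card) ∧
    (v ∈ Z → v ∈ X → (Finset.univ.filter (IsFree idx F v)).card = 1) ∧
    (v ∈ Z → v ∉ X → (Finset.univ.filter (IsFree idx F v)).card = 0) := by
  have h : (F.filter (v ∈ ·)).card + (Finset.univ.filter (IsFree idx F v)).card = 3 := by
    convert card_filter_mem_add_card_isFree hidx hF.1 v
  have h' := hF.2 v
  refine ⟨fun hv => ?_, fun hv hX => ?_, fun hv hX => ?_⟩
  · have := h'.1 hv
    rw [Nat.odd_iff] at this
    rw [Nat.even_iff]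
    omega
  · have := h'.2.1 hv hX
    omega
  · have := h'.2.2 hv hX
    omega

lemma IsPMgadget.isExtSet_extPart {V : Type} [Fintype V] {G : SimpleGraph V}
    {idx : V → Sym2 V → Fin 3} (hidx : ∀ v : V, Set.InjOn (idx v) (G.incidenceSet v))
    {Z X : Finset V} {M : Finset (Sym2 (HVert V))} (hM : IsPMgadget G idx Z X M) :
    IsExtSet G Z X (extPart G idx M) := by
  classical
  refine ⟨fun e he => (mem_extPart.1 he).1, fun v => ?_⟩
  have h : ((extPart G idx M).filter (v ∈ ·)).card +
      (Finset.univ.filter (IsFree idx (extPart G idx M) v)).card = 3 := by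
    convert card_filter_mem_add_card_isFree hidx
      (F := extPart G idx M) (fun e he => (mem_extPart.1 he).1) v
  refine ⟨fun hv => ?_, fun hv hX => ?_, fun hv hX => ?_⟩
  · have := (hM.even_card_isFree hv).1
    rw [Nat.even_iff] at this
    have h2 : ((extPart G idx M).filter (v ∈ ·)).card % 2 = 1 := by omega
    rw [Nat.odd_iff]
    convert h2
  · obtain ⟨ε, ⟨hε, hvε⟩, -⟩ := hM.2 (Sum.inr v) hX
    obtain ⟨i, rfl⟩ : ∃ i, ε = s(Sum.inr v, Sum.inl (v, i)) := by
      rcases mem_edgeSet_gadgetGraph.1 (hM.1 ε hε).1 with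
        ⟨e, he, rfl⟩ | ⟨u, hu, k, j, hkj, rfl⟩ | ⟨z, hz, k, rfl⟩
      · exact absurd hvε inr_notMem_extEdge
      · simp at hvε
      · simp only [Sym2.mem_iff, Sum.inr.injEq, reduceCtorEq, or_false] at hvε
        exact ⟨k, by rw [hvε]⟩
    have hset : Finset.univ.filter (IsFree idx (extPart G idx M) v) = {i} := by
      ext j
      simp only [Finset.mem_filter, Finset.mem_univ, true_and, Finset.mem_singleton]
      constructor
      · intro hj
        rcases hM.exists_of_isFree hj with h' | h'
        · exact absurd hv h'.1
        · have heq := hM.eq_of_mem h'.2.2 hε (x := Sum.inr v) (by simp) (by simp)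
          rw [Sym2.congr_right] at heq
          simpa using heq
      · rintro rfl
        exact hM.isFree_of_mem hε star_ne_extEdge (by simp)
    rw [hset, Finset.card_singleton] at h
    have h2 : ((extPart G idx M).filter (v ∈ ·)).card = 2 := by omega
    convert h2
  · have hset : Finset.univ.filter (IsFree idx (extPart G idx M) v) = ∅ := by
      rw [Finset.filter_eq_empty_iff]
      intro j _ hj
      rcases hM.exists_of_isFree hj with h' | h'
      · exact h'.1 hv
      · exact hX h'.2.1
    rw [hset, Finset.card_empty] at h
    have h2 : ((extPart G idx M).filter (v ∈ ·)).card = 3 := by omega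
    convert h2

lemma IsPMgadget.extendExt_extPart {V : Type} [Fintype V] {G : SimpleGraph V}
    {idx : V → Sym2 V → Fin 3} {Z X : Finset V} {M : Finset (Sym2 (HVert V))}
    (hM : IsPMgadget G idx Z X M) : extendExt idx Z X (extPart G idx M) = M := by
  ext ε
  rw [mem_extendExt]
  constructor
  · rintro (⟨e, he, rfl⟩ | ⟨v, hv, i, j, hij, hi, hj, rfl⟩ | ⟨z, hz, hzX, i, hi, rfl⟩)
    · exact (mem_extPart.1 he).2
    · exact (hM.even_card_isFree hv).2 i j hi hj hij
    · rcases hM.exists_of_isFree hi with h | h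
      · exact absurd hz h.1
      · exact h.2.2
  · intro hε
    rcases mem_edgeSet_gadgetGraph.1 (hM.1 ε hε).1 with
      ⟨e, he, rfl⟩ | ⟨v, hv, i, j, hij, rfl⟩ | ⟨z, hz, i, rfl⟩
    · exact Or.inl ⟨e, mem_extPart.2 ⟨he, hε⟩, rfl⟩
    · exact Or.inr (Or.inl ⟨v, hv, i, j, hij,
        hM.isFree_of_mem hε (triangle_ne_extEdge hij) (by simp),
        hM.isFree_of_mem hε (triangle_ne_extEdge hij) (by simp), rfl⟩)
    · exact Or.inr (Or.inr ⟨z, hz, (hM.1 _ hε).2 (Sum.inr z) (by simp), i,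
        hM.isFree_of_mem hε star_ne_extEdge (by simp), rfl⟩)

lemma IsExtSet.isPMgadget_extendExt {V : Type} [Fintype V] {G : SimpleGraph V}
    {idx : V → Sym2 V → Fin 3} (hidx : ∀ v : V, Set.InjOn (idx v) (G.incidenceSet v))
    {Z X : Finset V} (hXZ : X ⊆ Z) {F : Finset (Sym2 V)} (hF : IsExtSet G Z X F) :
    IsPMgadget G idx Z X (extendExt idx Z X F) := by
  classical
  refine ⟨?_, ?_⟩
  · intro ε hε
    rw [mem_edgeSet_gadgetGraph]
    rcases mem_extendExt.1 hε with
      ⟨e, he, rfl⟩ | ⟨v, hv, i, j, hij, hi, hj, rfl⟩ | ⟨z, hz, hzX, i, hi, rfl⟩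
    · refine ⟨Or.inl ⟨e, hF.1 e he, rfl⟩, ?_⟩
      rintro (x | x) hx
      · trivial
      · exact absurd hx inr_notMem_extEdge
    · refine ⟨Or.inr (Or.inl ⟨v, hv, i, j, hij, rfl⟩), ?_⟩
      rintro (x | x) hx
      · trivial
      · simp at hx
    · refine ⟨Or.inr (Or.inr ⟨z, hz, i, rfl⟩), ?_⟩
      rintro (x | x) hx
      · trivial
      · simp only [Sym2.mem_iff, Sum.inr.injEq, reduceCtorEq, or_false] at hx
        exact hx ▸ hzX
  · rintro (⟨v, i⟩ | z) hx
    · obtain ⟨hc1, hc2, hc3⟩ := hF.card_isFree hidx v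
      by_cases hi : IsFree idx F v i
      · have hmem : i ∈ Finset.univ.filter (IsFree idx F v) := by simpa using hi
        by_cases hv : v ∈ Z
        · have hvX : v ∈ X := by
            by_contra hvX
            rw [Finset.card_eq_zero.1 (hc3 hv hvX)] at hmem
            simp at hmem
          refine ⟨s(Sum.inr v, Sum.inl (v, i)), ⟨mem_extendExt.2
            (Or.inr (Or.inr ⟨v, hv, hvX, i, hi, rfl⟩)), by simp⟩, ?_⟩
          rintro ε ⟨hε, hvε⟩
          rcases mem_extendExt.1 hε with
            ⟨e, he, rfl⟩ | ⟨u, hu, k, j, hkj, hk, hj, rfl⟩ | ⟨z, hz, hzX, k, hk, rfl⟩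
          · obtain ⟨h1, h2⟩ := inl_mem_extEdge.1 hvε
            exact absurd h2 (hi e he h1)
          · simp only [Sym2.mem_iff, Sum.inl.injEq, Prod.mk.injEq] at hvε
            rcases hvε with ⟨rfl, -⟩ | ⟨rfl, -⟩ <;> exact absurd hv hu
          · simp only [Sym2.mem_iff, Sum.inl.injEq, Prod.mk.injEq, reduceCtorEq,
              false_or] at hvε
            obtain ⟨rfl, rfl⟩ := hvε
            rfl
        · obtain ⟨j, hj, hij, huniq⟩ := exists_unique_ne_of_even_fin_three _ (hc1 hv) i hmem
          refine ⟨s(Sum.inl (v, i), Sum.inl (v, j)), ⟨mem_extendExt.2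
            (Or.inr (Or.inl ⟨v, hv, i, j, hij, hi, by simpa using hj, rfl⟩)), by simp⟩, ?_⟩
          rintro ε ⟨hε, hvε⟩
          rcases mem_extendExt.1 hε with
            ⟨e, he, rfl⟩ | ⟨u, hu, k, l, hkl, hk, hl, rfl⟩ | ⟨z, hz, hzX, k, hk, rfl⟩
          · obtain ⟨h1, h2⟩ := inl_mem_extEdge.1 hvε
            exact absurd h2 (hi e he h1)
          · simp only [Sym2.mem_iff, Sum.inl.injEq, Prod.mk.injEq] at hvε
            rcases hvε with ⟨rfl, rfl⟩ | ⟨rfl, rfl⟩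
            · rw [huniq l (by simpa using hl) hkl]
            · rw [huniq k (by simpa using hk) hkl.symm, Sym2.eq_swap]
          · simp only [Sym2.mem_iff, Sum.inl.injEq, Prod.mk.injEq, reduceCtorEq,
              false_or] at hvε
            obtain ⟨rfl, -⟩ := hvε
            exact absurd hz hv
      · have hi' := hi
        simp only [IsFree, not_forall, not_not] at hi'
        obtain ⟨e, he, hve, hie⟩ := hi'
        refine ⟨extEdge idx e, ⟨mem_extendExt.2 (Or.inl ⟨e, he, rfl⟩),
          inl_mem_extEdge.2 ⟨hve, hie⟩⟩, ?_⟩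
        rintro ε ⟨hε, hvε⟩
        rcases mem_extendExt.1 hε with
          ⟨e', he', rfl⟩ | ⟨u, hu, k, l, hkl, hk, hl, rfl⟩ | ⟨z, hz, hzX, k, hk, rfl⟩
        · obtain ⟨h1, h2⟩ := inl_mem_extEdge.1 hvε
          rw [hidx v ⟨hF.1 e' he', h1⟩ ⟨hF.1 e he, hve⟩ (h2.trans hie.symm)]
        · simp only [Sym2.mem_iff, Sum.inl.injEq, Prod.mk.injEq] at hvε
          rcases hvε with ⟨rfl, rfl⟩ | ⟨rfl, rfl⟩
          · exact absurd hk hi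
          · exact absurd hl hi
        · simp only [Sym2.mem_iff, Sum.inl.injEq, Prod.mk.injEq, reduceCtorEq,
            false_or] at hvε
          obtain ⟨rfl, rfl⟩ := hvε
          exact absurd hk hi
    · have hzX : z ∈ X := hx
      obtain ⟨i, hset⟩ := Finset.card_eq_one.1 ((hF.card_isFree hidx z).2.1 (hXZ hzX) hzX)
      have hfree : ∀ j, IsFree idx F z j ↔ j = i := by
        intro j
        rw [← Finset.mem_singleton, ← hset]
        simp
      refine ⟨s(Sum.inr z, Sum.inl (z, i)), ⟨mem_extendExt.2
        (Or.inr (Or.inr ⟨z, hXZ hzX, hzX, i, (hfree i).2 rfl, rfl⟩)), by simp⟩, ?_⟩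
      rintro ε ⟨hε, hvε⟩
      rcases mem_extendExt.1 hε with
        ⟨e', he', rfl⟩ | ⟨u, hu, k, l, hkl, hk, hl, rfl⟩ | ⟨z', hz', hzX', k, hk, rfl⟩
      · exact absurd hvε inr_notMem_extEdge
      · simp at hvε
      · simp only [Sym2.mem_iff, Sum.inr.injEq, reduceCtorEq, or_false] at hvε
        subst hvε
        rw [(hfree k).1 hk]

open Classical in
/-- Perfect matchings of `H(X)` correspond to edge sets of `G` with prescribed degrees. -/
lemma pmPoly_eq_sum_isExtSet {V : Type} [Fintype V] [DecidableEq V] (G : SimpleGraph V)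
    (ℓ : Sym2 V → ℕ) (idx : V → Sym2 V → Fin 3)
    (hidx : ∀ v : V, Set.InjOn (idx v) (G.incidenceSet v)) {Z X : Finset V} (hXZ : X ⊆ Z) :
    pmPoly G ℓ idx Z X =
      ∑ F ∈ Finset.univ.filter (fun F : Finset (Sym2 V) => IsExtSet G Z X F),
        ∏ e ∈ F, (Polynomial.X : Polynomial ℤ) ^ ℓ e := by
  rw [pmPoly]
  refine Finset.sum_bij' (fun M _ => extPart G idx M) (fun F _ => extendExt idx Z X F)
    ?_ ?_ ?_ ?_ ?_
  · intro M hM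
    simp only [Finset.mem_filter, Finset.mem_univ, true_and] at hM ⊢
    exact hM.isExtSet_extPart hidx
  · intro F hF
    simp only [Finset.mem_filter, Finset.mem_univ, true_and] at hF ⊢
    exact hF.isPMgadget_extendExt hidx hXZ
  · intro M hM
    exact (Finset.mem_filter.1 hM).2.extendExt_extPart
  · intro F hF
    exact extPart_extendExt (Finset.mem_filter.1 hF).2.1
  · intro M _
    exact prod_wt_eq_prod_extPart G ℓ idx M

/-!
STATEMENT 3.  If no solution to Disjoint `A`,`B`-paths on the cubic graph `G`
exists, then `p(G,s) = 0` in `ℤ[s]`.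
-/
theorem stmt3 {V : Type} [Fintype V] [DecidableEq V]
    (G : SimpleGraph V) (A B : Finset V) (ℓ : Sym2 V → ℕ)
    (idx : V → Sym2 V → Fin 3)
    (hdisj : Disjoint A B) (hA : Even A.card) (hB : Even B.card)
    (hcubic : ∀ v : V, (G.neighborSet v).ncard = 3)
    (hidx : ∀ v : V, Set.InjOn (idx v) (G.incidenceSet v))
    (hℓ : ∀ e ∈ G.edgeSet, 1 ≤ ℓ e)
    (hnosol : ¬ ∃ E', IsSolution G A B E') :
    pPoly G A B ℓ idx = 0 := by
  classical
  have hpm : ∀ X ∈ (A ∪ B).powerset, (-1 : Polynomial ℤ) ^ (X ∩ A).card *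
      (pmPoly G ℓ idx (A ∪ B) X * pmPoly G ℓ idx (A ∪ B) ((A ∪ B) \ X)) =
      (-1 : Polynomial ℤ) ^ (X ∩ A).card *
      ((∑ F ∈ Finset.univ.filter (fun F => IsExtSet G (A ∪ B) X F),
          ∏ e ∈ F, (Polynomial.X : Polynomial ℤ) ^ ℓ e) *
        ∑ F ∈ Finset.univ.filter (fun F => IsExtSet G (A ∪ B) ((A ∪ B) \ X) F),
          ∏ e ∈ F, (Polynomial.X : Polynomial ℤ) ^ ℓ e) := by
    intro X hX
    rw [pmPoly_eq_sum_isExtSet G ℓ idx hidx (Finset.mem_powerset.1 hX),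
      pmPoly_eq_sum_isExtSet G ℓ idx hidx Finset.sdiff_subset]
  rw [pPoly, Finset.sum_congr rfl hpm]
  exact sum_isExtSet_eq_zero G A (A ∪ B) Finset.subset_union_left
    (fun e => (Polynomial.X : Polynomial ℤ) ^ ℓ e)
    (fun X => Finset.univ.filter (fun F => IsExtSet G (A ∪ B) X F)) (by simp)
    (fun X _ F F' hF hF' => exists_isOddClosed_symmDiff hdisj hidx hnosol hF hF')
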